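/- Let s ∈ ℕ, let P_{s,N} be any point set of N points in [0,1)^s, let p be a prime, let H_{p,N} be the first N points of the Halton sequence in base p, and let m ∈ ℕ be minimal such that N < p^m. Let γ = (γ_j)_{j≥1} be a non-increasing sequence of weights with 1 ≥ γ_1 ≥ γ_2 ≥ … > 0. Then for every σ_m ∈ ℚ(p^m), e²_{N,s+1}((P_{s,N}, H_{p,N} ⊕_{p,m}^{simi} σ_m)) ≤ p^m ∫_0^{p^{−m}} e²_{N,s+1}((P_{s,N}, H_{p,N} ⊕_p (σ_m + δ))) dδ, where (X,Y) denotes the point set of concatenated points (x_k, y_k), k = 0,…,N−1, formed from the k-th points of X and Y. -/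

import Mathlib

open MeasureTheory Finset

/-- The digit of `x ∈ [0,1)` at base-`p` position `r` (the coefficient of `p^{-(r+1)}`),
using the finite expansion for `p`-adic rationals. -/
noncomputable def rdigit (p : ℕ) (x : ℝ) (r : ℕ) : ℕ :=
  (⌊x * (p : ℝ) ^ (r + 1)⌋).toNat % p

/-- The value of the `p`-adic integer `φ_p^+(x)` modulo `p^m`, as a natural number. -/
noncomputable def truncVal (p : ℕ) (x : ℝ) (m : ℕ) : ℕ :=
  ∑ r ∈ Finset.range m, rdigit p x r * p ^ r

/-- Digit `r` of the `p`-adic sum `φ_p^+(x) +_{ℤ_p} φ_p^+(σ)`. -/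
noncomputable def sdigit (p : ℕ) (x σ : ℝ) (r : ℕ) : ℕ :=
  (truncVal p x (r + 1) + truncVal p σ (r + 1)) % p ^ (r + 1) / p ^ r

/-- The `p`-adic shift `x ⊕_p σ = φ_p(φ_p^+(x) +_{ℤ_p} φ_p^+(σ))` (the Monna map applied to
the `p`-adic sum, taken mod 1). -/
noncomputable def pshift (p : ℕ) (x σ : ℝ) : ℝ :=
  Int.fract (∑' r : ℕ, (sdigit p x σ r : ℝ) / (p : ℝ) ^ (r + 1))

/-- The simplified `p`-adic shift `x ⊕_{p,m}^{simp} σ`: the truncation of `x ⊕_p σ` to its `m`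
most significant base-`p` digits. -/
noncomputable def simpShift (p m : ℕ) (x σ : ℝ) : ℝ :=
  ∑ r ∈ Finset.range m, (sdigit p x σ r : ℝ) / (p : ℝ) ^ (r + 1)

/-- The mid-simplified `p`-adic shift `x ⊕_{p,m}^{simi} σ = (x ⊕_{p,m}^{simp} σ) + 1/(2p^m)`. -/
noncomputable def midShift (p m : ℕ) (x σ : ℝ) : ℝ :=
  simpShift p m x σ + 1 / (2 * (p : ℝ) ^ m)

/-- The radical inverse function `φ_p(n) = Σ_r n_r p^{-(r+1)}` in base `p`. -/
noncomputable def radInv (p n : ℕ) : ℝ :=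
  ∑' r : ℕ, ((n / p ^ r % p : ℕ) : ℝ) / (p : ℝ) ^ (r + 1)

/-- Membership in `ℚ(p^m) = {a p^{-m} : a = 0,1,…,p^m - 1}`. -/
def QSet (p m : ℕ) (x : ℝ) : Prop :=
  ∃ a : ℕ, a < p ^ m ∧ x = (a : ℝ) / (p : ℝ) ^ m

/-- The squared worst-case error of the QMC rule based on the `N`-element point set
`P ⊆ [0,1)^d` in the weighted anchored Sobolev space with weights `γ` (0-indexed, so the
paper's `γ_j` is `γ (j-1)`). -/
noncomputable def sqErr (d N : ℕ) (γ : ℕ → ℝ) (P : Fin N → Fin d → ℝ) : ℝ :=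
  (∏ j : Fin d, (1 + γ j.val / 3))
    - 2 / (N : ℝ) * ∑ n : Fin N, ∏ j : Fin d, (1 + γ j.val / 2 * (1 - P n j ^ 2))
    + 1 / (N : ℝ) ^ 2 *
        ∑ n : Fin N, ∑ h : Fin N, ∏ j : Fin d, (1 + γ j.val * min (1 - P n j) (1 - P h j))

section Digits

variable {p : ℕ}

lemma rdigit_lt (hp : 0 < p) (x : ℝ) (r : ℕ) : rdigit p x r < p := Nat.mod_lt _ hp

lemma truncVal_succ (p : ℕ) (x : ℝ) (m : ℕ) :
    truncVal p x (m + 1) = truncVal p x m + rdigit p x m * p ^ m :=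
  Finset.sum_range_succ _ _

lemma sdigit_eq (hp : 0 < p) (x σ : ℝ) (r : ℕ) :
    sdigit p x σ r =
      ((truncVal p x r + truncVal p σ r) / p ^ r + (rdigit p x r + rdigit p σ r)) % p := by
  have h : truncVal p x r + rdigit p x r * p ^ r + (truncVal p σ r + rdigit p σ r * p ^ r) =
      truncVal p x r + truncVal p σ r + p ^ r * (rdigit p x r + rdigit p σ r) := by ring
  rw [sdigit, pow_succ, Nat.mod_mul_right_div_self, truncVal_succ, truncVal_succ, h,
    Nat.add_mul_div_left _ _ (pow_pos hp r)]

lemma sdigit_lt (hp : 0 < p) (x σ : ℝ) (r : ℕ) : sdigit p x σ r < p := by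
  rw [sdigit_eq hp]
  exact Nat.mod_lt _ hp

lemma sdigit_comm (p : ℕ) (x σ : ℝ) (r : ℕ) : sdigit p x σ r = sdigit p σ x r := by
  rw [sdigit, sdigit, add_comm]

/-- The digits of the shifted point determine those of the original one. -/
lemma rdigit_eq_of_sdigit_eq (hp : 0 < p) {x x' σ : ℝ} {m : ℕ}
    (h : ∀ r < m, sdigit p x σ r = sdigit p x' σ r) :
    ∀ r < m, rdigit p x r = rdigit p x' r := by
  intro r
  induction r using Nat.strong_induction_on with
  | _ r ih =>
    intro hr
    have ht : truncVal p x r = truncVal p x' r :=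
      Finset.sum_congr rfl fun q hq => by
        rw [ih q (Finset.mem_range.1 hq) ((Finset.mem_range.1 hq).trans hr)]
    have hs := h r hr
    rw [sdigit_eq hp, sdigit_eq hp, ht] at hs
    have hs' : rdigit p x r ≡ rdigit p x' r [MOD p] :=
      Nat.ModEq.add_right_cancel' _ (Nat.ModEq.add_left_cancel' _ hs)
    exact Nat.ModEq.eq_of_lt_of_lt hs' (rdigit_lt hp _ _) (rdigit_lt hp _ _)

lemma rdigit_of_mem_cell (hp : 0 < p) {σ : ℝ} {k R q : ℕ} (hq : q < R)
    (hσ : σ ∈ Set.Ico ((k : ℝ) / (p : ℝ) ^ R) (((k : ℝ) + 1) / (p : ℝ) ^ R)) :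
    rdigit p σ q = k / p ^ (R - 1 - q) % p := by
  have hp' : (0 : ℝ) < p := by exact_mod_cast hp
  have hk : ⌊σ * (p : ℝ) ^ R⌋₊ = k := by
    have h1 := (div_le_iff₀ (pow_pos hp' R)).1 hσ.1
    exact (Nat.floor_eq_iff ((Nat.cast_nonneg k).trans h1)).2
      ⟨h1, (lt_div_iff₀ (pow_pos hp' R)).1 hσ.2⟩
  have hR : R = (q + 1) + (R - 1 - q) := by omega
  have he : σ * (p : ℝ) ^ (q + 1) = σ * (p : ℝ) ^ R / ((p ^ (R - 1 - q) : ℕ) : ℝ) := by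
    rw [eq_div_iff (by positivity)]
    push_cast
    rw [mul_assoc, ← pow_add, ← hR]
  rw [rdigit, Int.floor_toNat, he, Nat.floor_div_natCast, hk]

lemma rdigit_mid_of_mem_cell (hp : 0 < p) {σ : ℝ} {k r j : ℕ} (hj : j < p)
    (hσ : σ ∈ Set.Ico (((k * p + j : ℕ) : ℝ) / (p : ℝ) ^ (r + 1))
      ((((k * p + j : ℕ) : ℝ) + 1) / (p : ℝ) ^ (r + 1))) :
    rdigit p σ r = j := by
  rw [rdigit_of_mem_cell hp (Nat.lt_succ_self r) hσ]
  simp [Nat.mod_eq_of_lt hj]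

end Digits

section RadicalInverse

variable {p : ℕ}

lemma radInv_eq_ofDigits [NeZero p] (n : ℕ) :
    radInv p n = Real.ofDigits fun r => Fin.ofNat p (n / p ^ r) := by
  simp only [radInv, Real.ofDigits, Real.ofDigitsTerm, div_eq_mul_inv, Fin.val_ofNat]

lemma radInv_eq (hp : 0 < p) (n : ℕ) :
    radInv p n = ((n % p : ℕ) + radInv p (n / p)) / p := by
  have : NeZero p := ⟨hp.ne'⟩
  rw [radInv_eq_ofDigits, Real.ofDigits_eq_sum_add_ofDigits _ 1, radInv_eq_ofDigits]
  have h : ∀ i, n / p ^ (i + 1) = n / p / p ^ i := fun i => by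
    rw [pow_succ', Nat.div_div_eq_div_mul]
  simp only [h, Finset.sum_range_one, Real.ofDigitsTerm]
  simp
  ring

lemma radInv_nonneg (p n : ℕ) : 0 ≤ radInv p n := tsum_nonneg fun _ => by positivity

lemma radInv_lt_one (hp : 1 < p) (n : ℕ) : radInv p n < 1 := by
  induction n using Nat.strong_induction_on with
  | _ n ih =>
    rcases n.eq_zero_or_pos with rfl | hn
    · simp [radInv]
    · rw [radInv_eq (by omega), div_lt_one (by positivity)]
      have h1 := ih _ (Nat.div_lt_self hn hp)
      have h2 : ((n % p : ℕ) : ℝ) + 1 ≤ p := by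
        exact_mod_cast Nat.mod_lt n (by omega)
      linarith

lemma rdigit_radInv (hp : 1 < p) (n r : ℕ) : rdigit p (radInv p n) r = n / p ^ r % p := by
  have hp0 : (p : ℝ) ≠ 0 := by positivity
  induction r generalizing n with
  | zero =>
    have : radInv p n * (p : ℝ) ^ (0 + 1) = radInv p (n / p) + ((n % p : ℕ) : ℝ) := by
      rw [radInv_eq (by omega) n]
      field_simp
      ring
    rw [rdigit, this, Int.floor_toNat, Nat.floor_add_natCast (radInv_nonneg _ _),
      Nat.floor_eq_zero.2 (radInv_lt_one hp _)]
    simp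
  | succ r ih =>
    have : radInv p n * (p : ℝ) ^ (r + 1 + 1) =
        radInv p (n / p) * (p : ℝ) ^ (r + 1) + ((p * (n % p * p ^ r) : ℕ) : ℝ) := by
      rw [radInv_eq (by omega) n]
      push_cast
      field_simp
      ring
    rw [rdigit, this, Int.floor_toNat,
      Nat.floor_add_natCast (mul_nonneg (radInv_nonneg _ _) (by positivity)),
      Nat.add_mul_mod_self_left, pow_succ' p r, ← Nat.div_div_eq_div_mul, ← ih, rdigit,
      Int.floor_toNat]

lemma eq_of_rdigit_radInv_eq (hp : 1 < p) {n h m : ℕ} (hn : n < p ^ m) (hh : h < p ^ m)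
    (H : ∀ r < m, rdigit p (radInv p n) r = rdigit p (radInv p h) r) : n = h := by
  simp only [rdigit_radInv hp] at H
  induction m generalizing n h with
  | zero => simp at hn hh; omega
  | succ m ih =>
    have h0 := H 0 (by omega)
    have h1 : n / p = h / p := by
      refine ih ?_ ?_ fun r hr => ?_
      · rw [Nat.div_lt_iff_lt_mul (by omega), ← pow_succ]; exact hn
      · rw [Nat.div_lt_iff_lt_mul (by omega), ← pow_succ]; exact hh
      · have := H (r + 1) (by omega)
        rwa [pow_succ', ← Nat.div_div_eq_div_mul, ← Nat.div_div_eq_div_mul] at this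
    simp only [pow_zero, Nat.div_one] at h0
    rw [← Nat.div_add_mod n p, ← Nat.div_add_mod h p, h0, h1]

end RadicalInverse

section Numerators

/-- The natural number with base-`p` digits `d 0, …, d (m - 1)`, most significant first. -/
def digitNum (p : ℕ) (d : ℕ → ℕ) : ℕ → ℕ
  | 0 => 0
  | m + 1 => digitNum p d m * p + d m

variable {p : ℕ}

lemma sum_div_pow_eq_digitNum (hp : 0 < p) (d : ℕ → ℕ) (m : ℕ) :
    ∑ r ∈ Finset.range m, (d r : ℝ) / (p : ℝ) ^ (r + 1) = digitNum p d m / (p : ℝ) ^ m := by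
  have hp0 : (p : ℝ) ≠ 0 := by positivity
  induction m with
  | zero => simp [digitNum]
  | succ m ih =>
    rw [Finset.sum_range_succ, ih, digitNum]
    push_cast
    field_simp
    ring

lemma digitNum_injective {d e : ℕ → ℕ} (hd : ∀ r, d r < p) (he : ∀ r, e r < p) {m : ℕ}
    (h : digitNum p d m = digitNum p e m) : ∀ r < m, d r = e r := by
  have hp : 0 < p := (Nat.zero_le _).trans_lt (hd 0)
  induction m with
  | zero => simp
  | succ m ih =>
    simp only [digitNum] at h
    have hm : d m = e m := by
      simpa [Nat.mod_eq_of_lt, hd, he, Nat.mul_add_mod_self_right] using congrArg (· % p) h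
    have hq : digitNum p d m = digitNum p e m := by
      rw [hm] at h
      exact Nat.eq_of_mul_eq_mul_right hp (Nat.add_right_cancel h)
    intro r hr
    rcases Nat.lt_succ_iff_lt_or_eq.1 hr with hr | rfl
    · exact ih hq r hr
    · exact hm

/-- Distinct truncated shifts are separated by at least `p^{-m}`. -/
lemma simpShift_radInv_separated (hp : 1 < p) {m n h : ℕ} (σ : ℝ) (hn : n < p ^ m)
    (hh : h < p ^ m) (hne : n ≠ h) :
    simpShift p m (radInv p n) σ + ((p : ℝ) ^ m)⁻¹ ≤ simpShift p m (radInv p h) σ ∨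
      simpShift p m (radInv p h) σ + ((p : ℝ) ^ m)⁻¹ ≤ simpShift p m (radInv p n) σ := by
  have hp0 : 0 < p := by omega
  have hpm : (0 : ℝ) < (p : ℝ) ^ m := by positivity
  rw [simpShift, simpShift, sum_div_pow_eq_digitNum hp0 (sdigit p (radInv p n) σ),
    sum_div_pow_eq_digitNum hp0 (sdigit p (radInv p h) σ)]
  have key : digitNum p (sdigit p (radInv p n) σ) m ≠ digitNum p (sdigit p (radInv p h) σ) m :=
    fun H => hne <| eq_of_rdigit_radInv_eq hp hn hh <| rdigit_eq_of_sdigit_eq hp0 <|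
      digitNum_injective (sdigit_lt hp0 _ _) (sdigit_lt hp0 _ _) H
  rw [inv_eq_one_div, ← add_div, ← add_div, div_le_div_iff_of_pos_right hpm,
    div_le_div_iff_of_pos_right hpm]
  exact_mod_cast Nat.lt_or_gt_of_ne key

end Numerators

section Mean

variable {p : ℕ}

lemma measurable_rdigit (p r : ℕ) : Measurable fun x : ℝ => rdigit p x r :=
  (measurable_from_top (f := fun z : ℤ => z.toNat % p)).comp
    (Int.measurable_floor.comp (measurable_id.mul_const _))

lemma measurable_truncVal (p m : ℕ) : Measurable fun x : ℝ => truncVal p x m :=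
  Finset.measurable_sum _ fun r _ => (measurable_rdigit p r).mul_const _

lemma measurable_sdigit (p : ℕ) (x : ℝ) (r : ℕ) : Measurable fun σ : ℝ => sdigit p x σ r :=
  (measurable_from_top
    (f := fun t : ℕ => (truncVal p x (r + 1) + t) % p ^ (r + 1) / p ^ r)).comp
    (measurable_truncVal p (r + 1))

lemma measurable_cast_sdigit (p : ℕ) (x : ℝ) (r : ℕ) :
    Measurable fun σ : ℝ => (sdigit p x σ r : ℝ) :=
  measurable_from_top.comp (measurable_sdigit p x r)

lemma intervalIntegrable_sdigit (hp : 0 < p) (x : ℝ) (r : ℕ) (a b : ℝ) :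
    IntervalIntegrable (fun σ => (sdigit p x σ r : ℝ)) volume a b := by
  refine (intervalIntegrable_const (c := (p : ℝ))).mono_fun
    (measurable_cast_sdigit p x r).aestronglyMeasurable (Filter.Eventually.of_forall fun σ => ?_)
  simpa using (sdigit_lt hp x σ r).le

lemma sum_range_add_mod (p c : ℕ) :
    ∑ j ∈ Finset.range p, (c + j) % p = ∑ j ∈ Finset.range p, j := by
  induction c with
  | zero =>
    exact Finset.sum_congr rfl fun j hj => by simp [Nat.mod_eq_of_lt (Finset.mem_range.1 hj)]
  | succ c ih =>
    rw [← ih]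
    have h := (Finset.sum_range_succ' (fun j => (c + j) % p) p).symm.trans
      (Finset.sum_range_succ (fun j => (c + j) % p) p)
    simp only [add_zero, Nat.add_mod_right] at h
    rw [← Nat.add_right_cancel h]
    exact Finset.sum_congr rfl fun j _ => by rw [add_right_comm, add_assoc]

/-- On a `p`-adic cell of level `r`, digit `r` of the shifted point is equidistributed. -/
lemma integral_sdigit_cell (hp : 0 < p) (x : ℝ) (k r : ℕ) :
    ∫ σ in ((k : ℝ) / (p : ℝ) ^ r)..(((k : ℝ) + 1) / (p : ℝ) ^ r), (sdigit p x σ r : ℝ) =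
      ((p : ℝ) - 1) / 2 / (p : ℝ) ^ r := by
  have hp' : (0 : ℝ) < p := by exact_mod_cast hp
  set a : ℕ → ℝ := fun j => ((k * p + j : ℕ) : ℝ) / (p : ℝ) ^ (r + 1) with ha
  have ha0 : (k : ℝ) / (p : ℝ) ^ r = a 0 := by
    simp only [ha]; push_cast; field_simp; ring
  have hap : ((k : ℝ) + 1) / (p : ℝ) ^ r = a p := by
    simp only [ha]; push_cast; field_simp; ring
  have hmono : Monotone a := fun i j hij => by simp only [ha]; gcongr
  set T : ℕ := ∑ q ∈ Finset.range r, k / p ^ (r - 1 - q) % p * p ^ q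
  set c : ℕ := (truncVal p x r + T) / p ^ r + rdigit p x r with hc
  have hpiece : ∀ j ∈ Finset.range p, ∫ σ in a j..a (j + 1), (sdigit p x σ r : ℝ) =
      (((c + j) % p : ℕ) : ℝ) / (p : ℝ) ^ (r + 1) := by
    intro j hj
    have hj := Finset.mem_range.1 hj
    rw [intervalIntegral.integral_congr_Ioo_of_le (g := fun _ => (((c + j) % p : ℕ) : ℝ))
      (hmono j.le_succ) ?_]
    · rw [intervalIntegral.integral_const, smul_eq_mul]
      simp only [ha]; push_cast; field_simp; ring
    · intro σ hσ
      have hr : rdigit p σ r = j := rdigit_mid_of_mem_cell hp hj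
        ⟨hσ.1.le, by simpa [ha, add_assoc] using hσ.2⟩
      have hT : truncVal p σ r = T := Finset.sum_congr rfl fun q hq => by
        rw [rdigit_of_mem_cell hp (Finset.mem_range.1 hq)
          ⟨(ha0.trans_le (hmono j.zero_le)).trans hσ.1.le,
            hσ.2.trans_le ((hmono (Nat.succ_le_of_lt hj)).trans hap.ge)⟩]
      simp only [sdigit_eq hp, hr, hT, hc, add_assoc]
  rw [ha0, hap, ← intervalIntegral.sum_integral_adjacent_intervals
    fun j _ => intervalIntegrable_sdigit hp x r _ _, Finset.sum_congr rfl hpiece,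
    ← Finset.sum_div, ← Nat.cast_sum, sum_range_add_mod]
  have hs : ((∑ j ∈ Finset.range p, j : ℕ) : ℝ) * 2 = p * (p - 1) := by
    have := Finset.sum_range_id_mul_two p
    rw [← Nat.cast_pred hp]
    exact_mod_cast this
  rw [div_div, div_eq_div_iff (by positivity) (by positivity), pow_succ]
  linear_combination (p : ℝ) ^ r * hs

lemma integral_sdigit_of_le (hp : 0 < p) (x : ℝ) (a : ℕ) {m r : ℕ} (hmr : m ≤ r) :
    ∫ σ in ((a : ℝ) / (p : ℝ) ^ m)..(((a : ℝ) + 1) / (p : ℝ) ^ m), (sdigit p x σ r : ℝ) =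
      ((p : ℝ) - 1) / 2 / (p : ℝ) ^ m := by
  have hp' : (0 : ℝ) < p := by exact_mod_cast hp
  obtain ⟨t, rfl⟩ := Nat.exists_eq_add_of_le hmr
  set b : ℕ → ℝ := fun i => ((a * p ^ t + i : ℕ) : ℝ) / (p : ℝ) ^ (m + t) with hb
  have h0 : (a : ℝ) / (p : ℝ) ^ m = b 0 := by
    simp only [hb]; push_cast; field_simp; ring
  have h1 : ((a : ℝ) + 1) / (p : ℝ) ^ m = b (p ^ t) := by
    simp only [hb]; push_cast; field_simp; ring
  rw [h0, h1, ← intervalIntegral.sum_integral_adjacent_intervals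
    fun j _ => intervalIntegrable_sdigit hp x (m + t) _ _,
    Finset.sum_congr rfl (g := fun _ => ((p : ℝ) - 1) / 2 / (p : ℝ) ^ (m + t)) fun i _ => ?_]
  · rw [Finset.sum_const, Finset.card_range, nsmul_eq_mul]
    push_cast; field_simp; ring
  · rw [← integral_sdigit_cell hp x (a * p ^ t + i) (m + t)]
    simp only [hb, ← add_assoc, Nat.cast_add_one]

/-- The digits of the `p`-adic sum as a sequence in `Fin p`. -/
noncomputable def shiftDigits (p : ℕ) [NeZero p] (x σ : ℝ) : ℕ → Fin p :=
  fun r => ⟨sdigit p x σ r, sdigit_lt (NeZero.pos p) x σ r⟩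

lemma pshift_eq_fract_ofDigits [NeZero p] (x σ : ℝ) :
    pshift p x σ = Int.fract (Real.ofDigits (shiftDigits p x σ)) := by
  simp only [pshift, Real.ofDigits, Real.ofDigitsTerm, div_eq_mul_inv, shiftDigits]

lemma simpShift_eq_sum_ofDigitsTerm [NeZero p] (m : ℕ) (x σ : ℝ) :
    simpShift p m x σ = ∑ r ∈ Finset.range m, Real.ofDigitsTerm (shiftDigits p x σ) r := by
  simp only [simpShift, Real.ofDigitsTerm, div_eq_mul_inv, shiftDigits]

lemma measurable_ofDigits_shiftDigits [NeZero p] (x : ℝ) :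
    Measurable fun σ => Real.ofDigits (shiftDigits p x σ) :=
  Measurable.tsum fun r => (measurable_cast_sdigit p x r).mul_const _

lemma measurable_pshift (hp : 0 < p) (x : ℝ) : Measurable fun σ => pshift p x σ := by
  have : NeZero p := ⟨hp.ne'⟩
  simp only [pshift_eq_fract_ofDigits]
  exact (measurable_ofDigits_shiftDigits x).fract

/-- Within a cell of level `m` the truncated shift is constant. -/
lemma simpShift_eq_of_mem_cell (hp : 0 < p) (x : ℝ) {σ τ : ℝ} {a m : ℕ}
    (hσ : σ ∈ Set.Ico ((a : ℝ) / (p : ℝ) ^ m) (((a : ℝ) + 1) / (p : ℝ) ^ m))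
    (hτ : τ ∈ Set.Ico ((a : ℝ) / (p : ℝ) ^ m) (((a : ℝ) + 1) / (p : ℝ) ^ m)) :
    simpShift p m x σ = simpShift p m x τ := by
  refine Finset.sum_congr rfl fun r hr => ?_
  have h : ∀ q < m, rdigit p σ q = rdigit p τ q := fun q hq => by
    rw [rdigit_of_mem_cell hp hq hσ, rdigit_of_mem_cell hp hq hτ]
  have ht : truncVal p σ (r + 1) = truncVal p τ (r + 1) :=
    Finset.sum_congr rfl fun q hq => by
      rw [h q (by have := Finset.mem_range.1 hq; have := Finset.mem_range.1 hr; omega)]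
  rw [sdigit, sdigit, ht]

lemma ofDigits_shiftDigits_mem [NeZero p] (m : ℕ) (x σ : ℝ) :
    Real.ofDigits (shiftDigits p x σ) ∈
      Set.Icc (simpShift p m x σ) (simpShift p m x σ + ((p : ℝ) ^ m)⁻¹) := by
  have hi : (0 : ℝ) ≤ ((p : ℝ) ^ m)⁻¹ := by positivity
  rw [Real.ofDigits_eq_sum_add_ofDigits _ m, ← simpShift_eq_sum_ofDigitsTerm]
  exact ⟨le_add_of_nonneg_right (mul_nonneg hi (Real.ofDigits_nonneg _)),
    add_le_add_right (mul_le_of_le_one_right hi (Real.ofDigits_le_one _)) _⟩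

lemma shiftDigits_injOn [NeZero p] (hp : 1 < p) (x : ℝ) :
    Set.InjOn (shiftDigits p x) (Set.Ico 0 1) := by
  intro σ hσ τ hτ h
  have hd : ∀ r, rdigit p σ r = rdigit p τ r := fun r =>
    rdigit_eq_of_sdigit_eq (x := σ) (x' := τ) (σ := x) (m := r + 1) (by omega)
      (fun q _ => by
        rw [sdigit_comm, sdigit_comm p τ]
        exact congrArg Fin.val (congrFun h q)) r (by omega)
  rw [← Real.ofDigits_digits hp hσ, ← Real.ofDigits_digits hp hτ]
  congr 1
  funext r
  exact Fin.ext (hd r)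

lemma eq_last_of_ofDigits_eq_one (hp : 1 < p) {d : ℕ → Fin p}
    (h : Real.ofDigits d = 1) (r : ℕ) : (d r : ℕ) = p - 1 := by
  by_contra hne
  have hlt : (d r : ℕ) < p - 1 := by have := (d r).2; omega
  have hlast := Real.ofDigits_const_last_eq_one' hp
  refine (h.trans hlast.symm).not_lt (Summable.tsum_lt_tsum (i := r) (fun q => ?_) ?_
    Real.summable_ofDigitsTerm Real.summable_ofDigitsTerm)
  · simp only [Real.ofDigitsTerm]
    have : (d q : ℕ) ≤ p - 1 := by have := (d q).2; omega
    gcongr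
  · simp only [Real.ofDigitsTerm]
    gcongr

/-- Reduction mod 1 in the definition of the shift matters for at most one shift. -/
lemma ae_pshift_add_eq_ofDigits [NeZero p] (hp : 1 < p) (x τ : ℝ) {A : Set ℝ}
    (hA : MeasurableSet A) (hA1 : ∀ δ ∈ A, τ + δ ∈ Set.Ico (0 : ℝ) 1) :
    ∀ᵐ δ ∂volume.restrict A,
      pshift p x (τ + δ) = Real.ofDigits (shiftDigits p x (τ + δ)) := by
  have hs : Set.Subsingleton {δ ∈ A | Real.ofDigits (shiftDigits p x (τ + δ)) = 1} :=
    fun δ hδ ε hε => add_left_cancel <|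
      shiftDigits_injOn hp x (hA1 δ hδ.1) (hA1 ε hε.1) <| funext fun r =>
        Fin.ext <| (eq_last_of_ofDigits_eq_one hp hδ.2 r).trans
          (eq_last_of_ofDigits_eq_one hp hε.2 r).symm
  have h0 := measure_eq_zero_iff_ae_notMem.1 (hs.measure_zero volume)
  filter_upwards [ae_restrict_of_ae h0, ae_restrict_mem hA] with δ h1 h2
  rw [pshift_eq_fract_ofDigits, Int.fract_eq_self]
  exact ⟨Real.ofDigits_nonneg _, lt_of_le_of_ne (Real.ofDigits_le_one _) fun h => h1 ⟨h2, h⟩⟩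

lemma integral_ofDigits_shiftDigits [NeZero p] (hp : 1 < p) (x : ℝ) (a m : ℕ) :
    ∫ σ in ((a : ℝ) / (p : ℝ) ^ m)..(((a : ℝ) + 1) / (p : ℝ) ^ m),
        Real.ofDigits (shiftDigits p x σ) =
      ((p : ℝ) ^ m)⁻¹ * (midShift p m x (a / (p : ℝ) ^ m)) := by
  have hp0 : 0 < p := by omega
  have hp' : (0 : ℝ) < p := by exact_mod_cast hp0
  have hp1 : (1 : ℝ) < p := by exact_mod_cast hp
  set l : ℝ := (a : ℝ) / (p : ℝ) ^ m with hl
  set u : ℝ := ((a : ℝ) + 1) / (p : ℝ) ^ m with hu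
  have hlu : l ≤ u := by rw [hl, hu]; gcongr; linarith
  have hul : u - l = ((p : ℝ) ^ m)⁻¹ := by rw [hl, hu]; field_simp; ring
  have hgeo : HasSum (fun r => ((p : ℝ) - 1) * ((p : ℝ) ^ (r + 1))⁻¹) 1 := by
    have h := (Real.summable_ofDigitsTerm
      (digits := fun _ => (⟨p - 1, Nat.sub_one_lt_of_lt hp⟩ : Fin p))).hasSum
    have h1 := Real.ofDigits_const_last_eq_one' hp
    rw [Real.ofDigits] at h1
    rw [h1] at h
    rw [← Nat.cast_pred hp0]
    exact h
  set c : ℕ → ℝ := fun r => ∫ σ in l..u, Real.ofDigitsTerm (shiftDigits p x σ) r with hc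
  have hsum : HasSum c (∫ σ in l..u, Real.ofDigits (shiftDigits p x σ)) := by
    refine intervalIntegral.hasSum_integral_of_dominated_convergence
      (fun r _ => ((p : ℝ) - 1) * ((p : ℝ) ^ (r + 1))⁻¹) (fun r => ?_) (fun r => ?_) ?_ ?_ ?_
    · exact ((measurable_cast_sdigit p x r).mul_const _).aestronglyMeasurable
    · refine Filter.Eventually.of_forall fun σ _ => ?_
      rw [Real.norm_of_nonneg Real.ofDigitsTerm_nonneg]
      exact Real.ofDigitsTerm_le
    · exact Filter.Eventually.of_forall fun σ _ => hgeo.summable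
    · exact intervalIntegrable_const
    · exact Filter.Eventually.of_forall fun σ _ => Real.summable_ofDigitsTerm.hasSum
  have htail : HasSum (fun r => c (r + m)) (((p : ℝ) ^ m)⁻¹ * (1 / (2 * (p : ℝ) ^ m))) := by
    have hcr : ∀ r, c (r + m) = (((p : ℝ) ^ m)⁻¹ * (1 / (2 * (p : ℝ) ^ m))) *
        (((p : ℝ) - 1) * ((p : ℝ) ^ (r + 1))⁻¹) := fun r => by
      simp only [hc, Real.ofDigitsTerm, shiftDigits]
      rw [intervalIntegral.integral_mul_const, hl, hu,
        integral_sdigit_of_le hp0 x a (Nat.le_add_left m r)]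
      field_simp
      ring
    simp only [hcr]
    simpa using hgeo.mul_left (((p : ℝ) ^ m)⁻¹ * (1 / (2 * (p : ℝ) ^ m)))
  have hhead : ∑ r ∈ Finset.range m, c r = ((p : ℝ) ^ m)⁻¹ * simpShift p m x l := by
    simp only [hc]
    rw [← intervalIntegral.integral_finsetSum fun r _ => by
      exact (intervalIntegrable_sdigit hp0 x r _ _).mul_const _]
    simp only [← simpShift_eq_sum_ofDigitsTerm]
    rw [intervalIntegral.integral_congr_Ioo_of_le (g := fun _ => simpShift p m x l) hlu
      fun σ hσ => simpShift_eq_of_mem_cell hp0 x ⟨hσ.1.le, hσ.2⟩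
        ⟨le_rfl, hσ.1.trans hσ.2⟩]
    simp [hul]
  rw [← hsum.tsum_eq, ← hsum.summable.sum_add_tsum_nat_add m, hhead, htail.tsum_eq, midShift]
  ring

end Mean

section WorstCaseError

/-- The squared worst-case error as a function of the last coordinates `y` of the points, the
other coordinates entering through the coefficients `A` and `B`. -/
noncomputable def lastCoordErr {N : ℕ} (C g : ℝ) (A : Fin N → ℝ) (B : Fin N → Fin N → ℝ)
    (y : Fin N → ℝ) : ℝ :=
  C - 2 / (N : ℝ) * ∑ n, A n * (1 + g / 2 * (1 - y n ^ 2))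
    + 1 / (N : ℝ) ^ 2 * ∑ n, ∑ h, B n h * (1 + g * min (1 - y n) (1 - y h))

lemma sqErr_snoc {s N : ℕ} (γ : ℕ → ℝ) (P : Fin N → Fin s → ℝ) (y : Fin N → ℝ) :
    sqErr (s + 1) N γ (fun n => Fin.snoc (P n) (y n)) =
      lastCoordErr (∏ j : Fin (s + 1), (1 + γ j.val / 3)) (γ s)
        (fun n => ∏ j : Fin s, (1 + γ j.val / 2 * (1 - P n j ^ 2)))
        (fun n h => ∏ j : Fin s, (1 + γ j.val * min (1 - P n j) (1 - P h j))) y := by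
  rw [sqErr, lastCoordErr]
  refine congrArg₂ (· + ·) (congrArg₂ (· - ·) rfl (congrArg _ ?_)) (congrArg _ ?_)
  · refine Finset.sum_congr rfl fun n _ => ?_
    rw [Fin.prod_univ_castSucc]
    simp
  · refine Finset.sum_congr rfl fun n _ => Finset.sum_congr rfl fun h _ => ?_
    rw [Fin.prod_univ_castSucc]
    simp

variable {N : ℕ} {g w : ℝ} {A c : Fin N → ℝ}

lemma min_one_sub_eq_of_separated
    (hsep : ∀ n h, n ≠ h → c n + w ≤ c h ∨ c h + w ≤ c n) {y : Fin N → ℝ}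
    (hy : ∀ n, y n ∈ Set.Icc (c n) (c n + w)) (n h : Fin N) :
    min (1 - y n) (1 - y h) = 1 - y (if c n ≤ c h then h else n) := by
  have hn := hy n
  have hh := hy h
  rcases eq_or_ne n h with rfl | hne
  · simp
  have hs := hsep n h hne
  have hw : 0 ≤ w := by linarith [hn.1, hn.2]
  split_ifs with hc
  · refine min_eq_right ?_
    rcases hs with hs | hs <;> linarith [hn.1, hn.2, hh.1, hh.2]
  · refine min_eq_left ?_
    rcases hs with hs | hs <;> linarith [hn.1, hn.2, hh.1, hh.2]

/-- If the `y n` range over separated intervals of length `w`, then `lastCoordErr` lies above its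
tangent at the interval midpoints. -/
lemma lastCoordErr_add_tangent_le (C : ℝ) (B : Fin N → Fin N → ℝ) (hg : 0 ≤ g)
    (hA : ∀ n, 0 ≤ A n) (hsep : ∀ n h, n ≠ h → c n + w ≤ c h ∨ c h + w ≤ c n)
    (hw : 0 ≤ w) {y : Fin N → ℝ} (hy : ∀ n, y n ∈ Set.Icc (c n) (c n + w)) :
    lastCoordErr C g A B (fun n => c n + w / 2) +
        (∑ n, 2 / (N : ℝ) * A n * g * (c n + w / 2) * (y n - (c n + w / 2)) -
          ∑ n, ∑ h, 1 / (N : ℝ) ^ 2 * B n h * g *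
            (y (if c n ≤ c h then h else n) -
              (c (if c n ≤ c h then h else n) + w / 2))) ≤
      lastCoordErr C g A B y := by
  have hmid : ∀ n, c n + w / 2 ∈ Set.Icc (c n) (c n + w) := fun n =>
    ⟨by linarith, by linarith⟩
  simp only [lastCoordErr, min_one_sub_eq_of_separated hsep hy,
    min_one_sub_eq_of_separated (y := fun n => c n + w / 2) hsep hmid, Finset.mul_sum]
  have h1 : ∑ n, 2 / (N : ℝ) * (A n * (1 + g / 2 * (1 - y n ^ 2))) +
      ∑ n, 2 / (N : ℝ) * A n * g * (c n + w / 2) * (y n - (c n + w / 2)) ≤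
      ∑ n, 2 / (N : ℝ) * (A n * (1 + g / 2 * (1 - (c n + w / 2) ^ 2))) := by
    rw [← Finset.sum_add_distrib]
    refine Finset.sum_le_sum fun n _ => ?_
    have : 0 ≤ 2 / (N : ℝ) * A n * g / 2 * (y n - (c n + w / 2)) ^ 2 := by
      have := hA n
      positivity
    linarith
  have h2 : ∑ n, ∑ h, 1 / (N : ℝ) ^ 2 *
        (B n h * (1 + g * (1 - y (if c n ≤ c h then h else n)))) +
      ∑ n, ∑ h, 1 / (N : ℝ) ^ 2 * B n h * g *
        (y (if c n ≤ c h then h else n) - (c (if c n ≤ c h then h else n) + w / 2)) =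
      ∑ n, ∑ h, 1 / (N : ℝ) ^ 2 *
        (B n h * (1 + g * (1 - (c (if c n ≤ c h then h else n) + w / 2)))) := by
    simp only [← Finset.sum_add_distrib]
    refine Finset.sum_congr rfl fun n _ => Finset.sum_congr rfl fun h _ => ?_
    ring
  linarith

lemma lastCoordErr_midpoint_le_average {Ω : Type*} [MeasurableSpace Ω] (μ : Measure Ω)
    [IsFiniteMeasure μ] (C : ℝ) (B : Fin N → Fin N → ℝ) (hg : 0 ≤ g) (hA : ∀ n, 0 ≤ A n)
    (hsep : ∀ n h, n ≠ h → c n + w ≤ c h ∨ c h + w ≤ c n) (hw : 0 ≤ w)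
    {Y : Fin N → Ω → ℝ} (hYm : ∀ n, Measurable (Y n))
    (hY : ∀ n, ∀ᵐ ω ∂μ, Y n ω ∈ Set.Icc (c n) (c n + w))
    (hmean : ∀ n, ∫ ω, Y n ω ∂μ = μ.real Set.univ * (c n + w / 2)) :
    μ.real Set.univ * lastCoordErr C g A B (fun n => c n + w / 2) ≤
      ∫ ω, lastCoordErr C g A B (fun n => Y n ω) ∂μ := by
  have hYi : ∀ n, Integrable (Y n) μ := fun n =>
    Integrable.of_mem_Icc _ _ (hYm n).aemeasurable (hY n)
  have hY2 : ∀ n, Integrable (fun ω => Y n ω ^ 2) μ := fun n => by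
    refine Integrable.of_mem_Icc 0 ((|c n| + w) ^ 2) ((hYm n).pow_const 2).aemeasurable ?_
    filter_upwards [hY n] with ω hω
    refine ⟨sq_nonneg _, sq_le_sq' ?_ ?_⟩
    · linarith [hω.1, neg_abs_le (c n)]
    · linarith [hω.2, le_abs_self (c n)]
  have hdev : ∀ n, Integrable (fun ω => Y n ω - (c n + w / 2)) μ := fun n =>
    (hYi n).sub (integrable_const _)
  have hdev0 : ∀ n, ∫ ω, (Y n ω - (c n + w / 2)) ∂μ = 0 := fun n => by
    rw [integral_sub (hYi n) (integrable_const _), hmean n, integral_const, smul_eq_mul, sub_self]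
  have hE : Integrable (fun ω => lastCoordErr C g A B (fun n => Y n ω)) μ := by
    refine ((integrable_const _).sub (Integrable.const_mul (integrable_finsetSum _ fun n _ => ?_)
      _)).add (Integrable.const_mul (integrable_finsetSum _ fun n _ =>
        integrable_finsetSum _ fun h _ => ?_) _)
    · exact (((integrable_const _).add
        (((integrable_const _).sub (hY2 n)).const_mul _)).const_mul _)
    · exact ((integrable_const _).add ((((integrable_const _).sub (hYi n)).inf
        ((integrable_const _).sub (hYi h))).const_mul _)).const_mul _
  have hL1 : Integrable (fun ω => ∑ n, 2 / (N : ℝ) * A n * g * (c n + w / 2) *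
      (Y n ω - (c n + w / 2))) μ :=
    integrable_finsetSum _ fun n _ => (hdev n).const_mul _
  have hL2n : ∀ n, Integrable (fun ω => ∑ h, 1 / (N : ℝ) ^ 2 * B n h * g *
      (Y (if c n ≤ c h then h else n) ω - (c (if c n ≤ c h then h else n) + w / 2))) μ := fun n =>
    integrable_finsetSum _ fun h _ => (hdev _).const_mul _
  have hL2 : Integrable (fun ω => ∑ n, ∑ h, 1 / (N : ℝ) ^ 2 * B n h * g *
      (Y (if c n ≤ c h then h else n) ω - (c (if c n ≤ c h then h else n) + w / 2))) μ :=
    integrable_finsetSum _ fun n _ => hL2n n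
  have hmono := integral_mono_ae ((integrable_const _).add (hL1.sub hL2)) hE <| by
    filter_upwards [ae_all_iff.2 hY] with ω hω
    exact lastCoordErr_add_tangent_le C B hg hA hsep hw hω
  have hL10 : ∫ ω, ∑ n, 2 / (N : ℝ) * A n * g * (c n + w / 2) *
      (Y n ω - (c n + w / 2)) ∂μ = 0 := by
    rw [integral_finsetSum _ fun n _ => (hdev n).const_mul _]
    simp only [integral_const_mul, hdev0, mul_zero, Finset.sum_const_zero]
  have hL20 : ∫ ω, ∑ n, ∑ h, 1 / (N : ℝ) ^ 2 * B n h * g *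
      (Y (if c n ≤ c h then h else n) ω -
        (c (if c n ≤ c h then h else n) + w / 2)) ∂μ = 0 := by
    rw [integral_finsetSum _ fun n _ => hL2n n]
    refine Finset.sum_eq_zero fun n _ => ?_
    rw [integral_finsetSum _ fun h _ => (hdev _).const_mul _]
    simp only [integral_const_mul, hdev0, mul_zero, Finset.sum_const_zero]
  rw [integral_add' (integrable_const _) (hL1.sub hL2), integral_sub' hL1 hL2, hL10, hL20,
    integral_const, smul_eq_mul, sub_zero, add_zero] at hmono
  exact hmono

end WorstCaseError

/-- Lemma 2: multivariate version of Lemma 1, where a mid-simplified shifted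
van der Corput point set is appended as an additional coordinate to an arbitrary point set. -/
theorem midshift_error_le_average_concat
    (s N : ℕ) (hN : 1 ≤ N) (P : Fin N → Fin s → ℝ)
    (hP : ∀ n j, P n j ∈ Set.Ico (0 : ℝ) 1)
    (p : ℕ) (hp : p.Prime)
    (m : ℕ) (hm : 0 < m) (hmN : N < p ^ m) (hmmin : ∀ k, 0 < k → N < p ^ k → m ≤ k)
    (γ : ℕ → ℝ) (hγpos : ∀ j, 0 < γ j) (hγ1 : γ 0 ≤ 1) (hγmon : Antitone γ)
    (σm : ℝ) (hσ : QSet p m σm) :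
    sqErr (s + 1) N γ (fun n => Fin.snoc (P n) (midShift p m (radInv p n.val) σm)) ≤
      (p : ℝ) ^ m *
        ∫ δ in Set.Ico (0 : ℝ) (((p : ℝ) ^ m)⁻¹),
          sqErr (s + 1) N γ fun n => Fin.snoc (P n) (pshift p (radInv p n.val) (σm + δ)) := by
  obtain ⟨a, ha, rfl⟩ := hσ
  have : NeZero p := ⟨hp.ne_zero⟩
  have hp' : (0 : ℝ) < p := by exact_mod_cast hp.pos
  have hpm : (0 : ℝ) < (p : ℝ) ^ m := by positivity
  set w : ℝ := ((p : ℝ) ^ m)⁻¹ with hw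
  have hw0 : 0 < w := inv_pos.2 hpm
  have hend : (a : ℝ) / (p : ℝ) ^ m + w = ((a : ℝ) + 1) / (p : ℝ) ^ m := by
    rw [hw]; field_simp
  have hend1 : ((a : ℝ) + 1) / (p : ℝ) ^ m ≤ 1 := by
    rw [div_le_one hpm]
    exact_mod_cast ha
  have hmid : ∀ x, midShift p m x (a / (p : ℝ) ^ m) =
      simpShift p m x (a / (p : ℝ) ^ m) + w / 2 := fun x => by
    rw [midShift, hw]; field_simp
  have hcell : ∀ δ ∈ Set.Ico 0 w, (a : ℝ) / (p : ℝ) ^ m + δ ∈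
      Set.Ico ((a : ℝ) / (p : ℝ) ^ m) (((a : ℝ) + 1) / (p : ℝ) ^ m) := fun δ hδ =>
    ⟨by linarith [hδ.1], by linarith [hδ.2]⟩
  have hleft := hcell 0 ⟨le_rfl, hw0⟩
  rw [add_zero] at hleft
  have hae : ∀ x, ∀ᵐ δ ∂volume.restrict (Set.Ico 0 w), pshift p x (a / (p : ℝ) ^ m + δ) =
      Real.ofDigits (shiftDigits p x (a / (p : ℝ) ^ m + δ)) := fun x =>
    ae_pshift_add_eq_ofDigits hp.one_lt x _ measurableSet_Ico fun δ hδ =>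
      ⟨(by positivity : (0 : ℝ) ≤ a / (p : ℝ) ^ m).trans (hcell δ hδ).1,
        (hcell δ hδ).2.trans_le hend1⟩
  have hreal : (volume.restrict (Set.Ico 0 w)).real Set.univ = w := by
    simp [hw0.le]
  have key := lastCoordErr_midpoint_le_average (volume.restrict (Set.Ico 0 w)) (g := γ s) (w := w)
    (A := fun n => ∏ j : Fin s, (1 + γ j.val / 2 * (1 - P n j ^ 2)))
    (c := fun n => simpShift p m (radInv p n.val) (a / (p : ℝ) ^ m))
    (Y := fun n δ => pshift p (radInv p n.val) (a / (p : ℝ) ^ m + δ))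
    (∏ j : Fin (s + 1), (1 + γ j.val / 3))
    (fun n h => ∏ j : Fin s, (1 + γ j.val * min (1 - P n j) (1 - P h j)))
    (hγpos s).le
    (fun n => Finset.prod_nonneg fun j _ => by
      have := hP n j
      have : 0 ≤ 1 - P n j ^ 2 := by nlinarith [this.1, this.2]
      have := hγpos j
      positivity)
    (fun n h hne => simpShift_radInv_separated hp.one_lt _ (n.2.trans hmN) (h.2.trans hmN)
      (Fin.val_ne_of_ne hne))
    hw0.le
    (fun n => (measurable_pshift hp.pos _).comp (measurable_const_add _))
    (fun n => by
      filter_upwards [hae (radInv p n.val), ae_restrict_mem measurableSet_Ico] with δ hδ hδw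
      rw [hδ, simpShift_eq_of_mem_cell hp.pos _ hleft (hcell δ hδw)]
      exact ofDigits_shiftDigits_mem m _ _)
    (fun n => by
      rw [hreal, integral_congr_ae (hae _), integral_Ico_eq_integral_Ioc,
        ← intervalIntegral.integral_of_le hw0.le,
        intervalIntegral.integral_comp_add_left
          (fun σ => Real.ofDigits (shiftDigits p (radInv p n.val) σ)),
        add_zero, hend, integral_ofDigits_shiftDigits hp.one_lt, hmid])
  rw [hreal] at key
  simp only [sqErr_snoc, hmid]
  rw [← div_le_iff₀' hpm, div_eq_inv_mul]
  exact key
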